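/- arXiv:2102.03094 — 3 statements merged into one kernel-verified Lean document; each statement's English description precedes it below -/
import Mathlib

section
/- Sandwich bound for irregular-distance codes: let M ∈ ℕ, let D ∈ ℕ^{M×M} be a distance matrix, and set D_max = max_{i,j} D_{ij}. If M ≤ D_max² and D_max ≥ 10, then D_max ≤ N(M,D) ≤ 2·D_max / (1 − 2√(ln D_max / D_max)). -/
/-- `p` is an `[M,D]`-code of length `r` over `ℤ₂`. -/
def IsIrregularCode {M r : ℕ} (D : Matrix (Fin M) (Fin M) ℕ)
    (p : Fin M → (Fin r → ZMod 2)) : Prop :=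
  ∀ i j, D i j ≤ hammingDist (p i) (p j)

/-- `N(M,D)`: the smallest length `r` for which an `[M,D]`-code of length `r` exists. -/
noncomputable def Ncode (M : ℕ) (D : Matrix (Fin M) (Fin M) ℕ) : ℕ :=
  sInf {r : ℕ | ∃ p : Fin M → (Fin r → ZMod 2), IsIrregularCode D p}

open Finset in
/-- Exponential generating sum of the Hamming distance from a fixed binary word. -/
lemma sum_exp_neg_mul_hammingDist {r : ℕ} (c : Fin r → ZMod 2) (l : ℝ) :
    ∑ x : Fin r → ZMod 2, Real.exp (-l * hammingDist c x) = (1 + Real.exp (-l)) ^ r := by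
  have hterm (x : Fin r → ZMod 2) : Real.exp (-l * hammingDist c x) =
      ∏ i, (if c i ≠ x i then Real.exp (-l) else 1) := by
    rw [prod_ite, prod_const, prod_const_one, mul_one, ← Real.exp_nat_mul, mul_comm]
    rfl
  have hcoord (a : ZMod 2) :
      ∑ b : ZMod 2, (if a ≠ b then Real.exp (-l) else 1) = 1 + Real.exp (-l) := by
    rw [show (univ : Finset (ZMod 2)) = {0, 1} by decide, sum_pair (by decide)]
    obtain rfl | rfl : a = 0 ∨ a = 1 := by
      revert a
      decide
    · simp
    · simp [add_comm]
  simp_rw [hterm]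
  rw [← Fintype.prod_sum (fun i b => if c i ≠ b then Real.exp (-l) else 1)]
  simp only [hcoord, prod_const, card_univ, Fintype.card_fin]

open Finset in
/-- Chernoff bound for the size of an open Hamming ball of binary words. -/
lemma card_hammingDist_lt_le {r d : ℕ} (c : Fin r → ZMod 2) {l : ℝ} (hl : 0 ≤ l) :
    (#{x : Fin r → ZMod 2 | hammingDist c x < d} : ℝ) ≤
      2 ^ r * Real.exp (l * (d - 1) - l * r / 2 + l ^ 2 * r / 8) := by
  have hlower : (#{x : Fin r → ZMod 2 | hammingDist c x < d} : ℝ) * Real.exp (-l * (d - 1)) ≤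
      (1 + Real.exp (-l)) ^ r := by
    rw [← sum_exp_neg_mul_hammingDist c l, ← nsmul_eq_mul]
    refine (card_nsmul_le_sum _ _ _ fun x hx => ?_).trans
      (sum_le_sum_of_subset_of_nonneg (subset_univ _) fun _ _ _ => (Real.exp_pos _).le)
    have hx' : (hammingDist c x : ℝ) + 1 ≤ d := by
      exact_mod_cast (mem_filter.mp hx).2
    apply Real.exp_le_exp.mpr
    nlinarith
  have hbase : 1 + Real.exp (-l) ≤ 2 * Real.exp (-l / 2 + l ^ 2 / 8) := by
    have hcosh : Real.cosh (l / 2) ≤ Real.exp (l ^ 2 / 8) := by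
      convert Real.cosh_le_exp_half_sq (l / 2) using 2
      ring
    have heq : 1 + Real.exp (-l) = 2 * (Real.exp (-l / 2) * Real.cosh (l / 2)) := by
      rw [Real.cosh_eq, ← mul_div_assoc, mul_div_cancel₀ _ two_ne_zero, mul_add,
        ← Real.exp_add, ← Real.exp_add]
      ring_nf
      simp [add_comm]
    rw [heq, Real.exp_add]
    gcongr
  calc (#{x : Fin r → ZMod 2 | hammingDist c x < d} : ℝ)
      = #{x : Fin r → ZMod 2 | hammingDist c x < d} * Real.exp (-l * (d - 1)) *
          Real.exp (l * (d - 1)) := by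
        rw [mul_assoc, ← Real.exp_add]
        simp
    _ ≤ (2 * Real.exp (-l / 2 + l ^ 2 / 8)) ^ r * Real.exp (l * (d - 1)) := by
        gcongr
        exact hlower.trans (by gcongr)
    _ = 2 ^ r * Real.exp (l * (d - 1) - l * r / 2 + l ^ 2 * r / 8) := by
        rw [mul_pow, ← Real.exp_nat_mul, mul_assoc, ← Real.exp_add]
        ring_nf

open Finset in
/-- Greedy (Gilbert–Varshamov) construction from a uniform bound on the size of Hamming balls. -/
lemma exists_code_of_card_ball_le {r d : ℕ} {V : ℝ} (hV : 0 ≤ V)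
    (hball : ∀ c : Fin r → ZMod 2,
      (#{x : Fin r → ZMod 2 | hammingDist c x < d} : ℝ) ≤ V) (M : ℕ) (hM : M * V < 2 ^ r) :
    ∃ p : Fin M → (Fin r → ZMod 2), ∀ i j, i ≠ j → d ≤ hammingDist (p i) (p j) := by
  induction M with
  | zero => exact ⟨Fin.elim0, fun i => i.elim0⟩
  | succ m ih =>
    push_cast at hM
    obtain ⟨p, hp⟩ := ih (by nlinarith)
    obtain ⟨x, hx⟩ : ∃ x, ∀ i, d ≤ hammingDist (p i) x := by
      by_contra! hcover
      have hsub : (univ : Finset (Fin r → ZMod 2)) ⊆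
          univ.biUnion fun i => {x | hammingDist (p i) x < d} := fun x _ => by
        simpa using hcover x
      have hcard : (2 ^ r : ℝ) ≤ ∑ i, (#{x | hammingDist (p i) x < d} : ℝ) := by
        have := (card_le_card hsub).trans card_biUnion_le
        rw [card_univ, Fintype.card_fun, ZMod.card, Fintype.card_fin] at this
        exact_mod_cast this
      have hsum := hcard.trans (sum_le_sum fun i _ => hball (p i))
      simp only [sum_const, card_univ, Fintype.card_fin, nsmul_eq_mul] at hsum
      linarith
    refine ⟨Fin.cons x p, fun i j hij => ?_⟩
    induction i using Fin.cases with
    | zero =>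
      induction j using Fin.cases with
      | zero => exact absurd rfl hij
      | succ j => simpa [hammingDist_comm] using hx j
    | succ i =>
      induction j using Fin.cases with
      | zero => simpa using hx i
      | succ j => simpa using hp i j fun h => hij (congrArg _ h)

lemma two_mul_sqrt_log_div_self_lt_one {x : ℝ} (hx : 10 ≤ x) :
    2 * Real.sqrt (Real.log x / x) < 1 := by
  have hx0 : 0 < x := by linarith
  have hlog : Real.log x < x / 4 := by
    have h8 : Real.log 8 = 3 * Real.log 2 := by
      rw [show (8 : ℝ) = 2 ^ 3 by norm_num, Real.log_pow]
      norm_num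
    have hdiv : Real.log (x / 8) ≤ x / 8 - 1 := Real.log_le_sub_one_of_pos (by positivity)
    rw [Real.log_div hx0.ne' (by norm_num), h8] at hdiv
    linarith [Real.log_two_lt_d9]
  have : Real.sqrt (Real.log x / x) < 1 / 2 := by
    rw [Real.sqrt_lt' (by norm_num), div_lt_iff₀ hx0]
    linarith
  linarith

/-- Binary codes with `d ^ 2` words and minimum distance `d`. -/
lemma exists_code_floor {M d : ℕ} (hM : M ≤ d ^ 2) (hd : 10 ≤ d) :
    ∃ p : Fin M →
        (Fin ⌊2 * (d : ℝ) / (1 - 2 * Real.sqrt (Real.log d / d))⌋₊ → ZMod 2),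
      ∀ i j, i ≠ j → d ≤ hammingDist (p i) (p j) := by
  have hd' : (10 : ℝ) ≤ d := by exact_mod_cast hd
  have hd0 : (0 : ℝ) < d := by linarith
  have hlog : 0 ≤ Real.log d := Real.log_nonneg (by linarith)
  have hsqrt := two_mul_sqrt_log_div_self_lt_one hd'
  set e := Real.sqrt (Real.log d / d) with he
  have he0 : 0 ≤ e := Real.sqrt_nonneg _
  have hesq : e ^ 2 * d = Real.log d := by
    rw [he, Real.sq_sqrt (by positivity)]
    field_simp
  set R : ℝ := 2 * d / (1 - 2 * e) with hR
  have hRmul : R * (1 - 2 * e) = 2 * d := div_mul_cancel₀ _ (by linarith)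
  have hR0 : 0 ≤ R := div_nonneg (by positivity) (by linarith)
  have hRd : 2 * d ≤ R := by nlinarith
  have hfloor := Nat.floor_le hR0
  have hfloor' := Nat.lt_floor_add_one R
  set r := ⌊R⌋₊
  refine exists_code_of_card_ball_le (V := 2 ^ r * Real.exp (-4 * Real.log d)) (by positivity)
    (fun c => (card_hammingDist_lt_le c (l := 4 * e) (by positivity)).trans ?_) M ?_
  · gcongr
    have h1 : 4 * e * ((d : ℝ) - 1 - r / 2) ≤ 4 * e * (-(e * R)) := by
      gcongr
      linarith
    have h2 : e ^ 2 * r ≤ e ^ 2 * R := by gcongr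
    have h3 : e ^ 2 * (2 * d) ≤ e ^ 2 * R := by gcongr
    linarith
  · have hexp : Real.exp (-4 * Real.log d) = ((d : ℝ) ^ 4)⁻¹ := by
      rw [neg_mul, Real.exp_neg, show (4 : ℝ) = (4 : ℕ) by norm_num, Real.exp_nat_mul,
        Real.exp_log hd0]
    have hM' : (M : ℝ) ≤ (d : ℝ) ^ 2 := by exact_mod_cast hM
    have hlt : M * ((d : ℝ) ^ 4)⁻¹ < 1 := by
      rw [← div_eq_mul_inv, div_lt_one (by positivity)]
      exact hM'.trans_lt (pow_lt_pow_right₀ (by linarith) (by norm_num))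
    rw [hexp, mul_left_comm]
    exact mul_lt_of_lt_one_right (by positivity) hlt

/-- Sandwich bound for irregular-distance codes: with `Dmax = max_{i,j} D_{ij}`,
if `M ≤ Dmax²` and `Dmax ≥ 10`, then
`Dmax ≤ N(M,D) ≤ 2·Dmax/(1 − 2√(ln Dmax / Dmax))`. -/
theorem irregular_code_sandwich (M : ℕ) (D : Matrix (Fin M) (Fin M) ℕ)
    (hsymm : D.IsSymm) (hdiag : ∀ i, D i i = 0)
    (Dmax : ℕ) (hDmax : Dmax = Finset.univ.sup (fun ij : Fin M × Fin M => D ij.1 ij.2))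
    (hM : M ≤ Dmax ^ 2) (hD : 10 ≤ Dmax) :
    Dmax ≤ Ncode M D ∧
      (Ncode M D : ℝ) ≤ 2 * (Dmax : ℝ) / (1 - 2 * Real.sqrt (Real.log Dmax / Dmax)) := by
  set R : ℝ := 2 * (Dmax : ℝ) / (1 - 2 * Real.sqrt (Real.log Dmax / Dmax))
  have hR0 : 0 ≤ R := div_nonneg (by positivity)
    (by linarith [two_mul_sqrt_log_div_self_lt_one (x := Dmax) (by exact_mod_cast hD)])
  have hmem : ⌊R⌋₊ ∈ {r : ℕ | ∃ p : Fin M → (Fin r → ZMod 2), IsIrregularCode D p} := by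
    obtain ⟨p, hp⟩ := exists_code_floor hM hD
    refine ⟨p, fun i j => ?_⟩
    obtain rfl | hij := eq_or_ne i j
    · simp [hdiag]
    · refine le_trans ?_ (hp i j hij)
      rw [hDmax]
      exact Finset.le_sup (f := fun ij : Fin M × Fin M => D ij.1 ij.2) (Finset.mem_univ (i, j))
  constructor
  · obtain ⟨q, hq⟩ := Nat.sInf_mem ⟨_, hmem⟩
    rw [hDmax]
    refine Finset.sup_le fun ij _ => (hq ij.1 ij.2).trans ?_
    simpa [Ncode] using hammingDist_le_card_fintype (x := q ij.1) (y := q ij.2)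
  · exact (Nat.cast_le.mpr (Nat.sInf_le hmem)).trans (Nat.floor_le hR0)
end

section
/- Tightness criterion: let f : ℤ₂^k → S have image {f_1, …, f_E} and let t ∈ ℕ. If there exist representatives u_1, …, u_E ∈ ℤ₂^k with f(u_i) = f_i for each i and such that the distance requirement matrix D_f(t, u_1, …, u_E) equals the function-distance matrix D_f(t, f_1, …, f_E), then r_f(k,t) = N(E, D_f(t, f_1, …, f_E)). -/
/-- The systematic encoding `u ↦ (u, p u)` is a function-correcting code for `f`
tolerating `t` errors. -/
def IsFCC {k r : ℕ} {S : Type*} (t : ℕ) (f : (Fin k → ZMod 2) → S)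
    (p : (Fin k → ZMod 2) → (Fin r → ZMod 2)) : Prop :=
  ∀ u₁ u₂ : Fin k → ZMod 2, f u₁ ≠ f u₂ →
    2 * t + 1 ≤ hammingDist u₁ u₂ + hammingDist (p u₁) (p u₂)

/-- `r_f(k,t)`: the optimal (smallest) redundancy of an FCC for `f` tolerating `t` errors. -/
noncomputable def FCCredundancy {k : ℕ} {S : Type*} (f : (Fin k → ZMod 2) → S)
    (t : ℕ) : ℕ :=
  sInf {r : ℕ | ∃ p : (Fin k → ZMod 2) → (Fin r → ZMod 2), IsFCC t f p}

/-- The distance requirement matrix `D_f(t, u_1, …, u_M)`. -/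
def distReqMatrix {k M : ℕ} {S : Type*} [DecidableEq S] (f : (Fin k → ZMod 2) → S)
    (t : ℕ) (u : Fin M → (Fin k → ZMod 2)) : Matrix (Fin M) (Fin M) ℕ :=
  fun i j => if f (u i) ≠ f (u j) then 2 * t + 1 - hammingDist (u i) (u j) else 0

/-- `d_f(s₁,s₂)`: the smallest Hamming distance between information vectors evaluating
to the function values `s₁` and `s₂`. -/
noncomputable def funcDist {k : ℕ} {S : Type*} (f : (Fin k → ZMod 2) → S)
    (s₁ s₂ : S) : ℕ :=
  sInf {n : ℕ | ∃ u₁ u₂ : Fin k → ZMod 2,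
    f u₁ = s₁ ∧ f u₂ = s₂ ∧ hammingDist u₁ u₂ = n}

/-- The function-distance matrix `D_f(t, f_1, …, f_E)`. -/
noncomputable def funcDistMatrix {k E : ℕ} {S : Type*} (f : (Fin k → ZMod 2) → S)
    (t : ℕ) (fv : Fin E → S) : Matrix (Fin E) (Fin E) ℕ :=
  fun i j => if i = j then 0 else 2 * t + 1 - funcDist f (fv i) (fv j)

theorem IsFCC.isIrregularCode_distReqMatrix {k r M : ℕ} {S : Type*} [DecidableEq S] {t : ℕ}
    {f : (Fin k → ZMod 2) → S} {p : (Fin k → ZMod 2) → (Fin r → ZMod 2)} (hp : IsFCC t f p)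
    (u : Fin M → (Fin k → ZMod 2)) :
    IsIrregularCode (distReqMatrix f t u) (p ∘ u) := by
  intro i j
  unfold distReqMatrix
  split_ifs with h
  · exact Nat.sub_le_iff_le_add'.2 (hp (u i) (u j) h)
  · exact Nat.zero_le _

theorem funcDist_le_hammingDist {k : ℕ} {S : Type*} (f : (Fin k → ZMod 2) → S)
    (u₁ u₂ : Fin k → ZMod 2) : funcDist f (f u₁) (f u₂) ≤ hammingDist u₁ u₂ :=
  Nat.sInf_le ⟨u₁, u₂, rfl, rfl, rfl⟩

theorem IsIrregularCode.exists_isFCC {k r t E : ℕ} {S : Type*} {f : (Fin k → ZMod 2) → S}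
    {fv : Fin E → S} (hrange : Set.range f ⊆ Set.range fv) {p : Fin E → (Fin r → ZMod 2)}
    (hp : IsIrregularCode (funcDistMatrix f t fv) p) :
    ∃ q : (Fin k → ZMod 2) → (Fin r → ZMod 2), IsFCC t f q := by
  choose g hg using fun v => hrange (Set.mem_range_self v)
  refine ⟨p ∘ g, fun u₁ u₂ hne => ?_⟩
  have hgne : g u₁ ≠ g u₂ := fun h => hne (by rw [← hg u₁, ← hg u₂, h])
  have hcode := hp (g u₁) (g u₂)
  rw [funcDistMatrix, if_neg hgne, hg, hg] at hcode
  have hdist := funcDist_le_hammingDist f u₁ u₂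
  simp only [Function.comp_apply]
  omega


/-- Tightness criterion: if there are representatives `u_i` with `f (u i) = fv i` whose
distance requirement matrix coincides with the function-distance matrix, then
`r_f(k,t) = N(E, D_f(t, f_1, …, f_E))`. -/
theorem fcc_tightness {k t E : ℕ} {S : Type*} [DecidableEq S]
    (f : (Fin k → ZMod 2) → S)
    (fv : Fin E → S) (hinj : Function.Injective fv)
    (hrange : Set.range fv = Set.range f)
    (u : Fin E → (Fin k → ZMod 2)) (hrep : ∀ i, f (u i) = fv i)
    (hmat : distReqMatrix f t u = funcDistMatrix f t fv) :
    FCCredundancy f t = Ncode E (funcDistMatrix f t fv) := by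
  unfold FCCredundancy Ncode
  congr 1
  ext r
  constructor
  · rintro ⟨p, hp⟩
    exact ⟨p ∘ u, hmat ▸ hp.isIrregularCode_distReqMatrix u⟩
  · rintro ⟨p, hp⟩
    exact hp.exists_isFCC hrange.ge
end

section
/- Optimal redundancy for locally binary functions: let f : ℤ₂^k → S be a 2t-locally binary function whose image has at least 2 elements. Then the optimal redundancy satisfies r_f(k,t) = 2t. -/
/-- The function ball of `f` with radius `ρ` around `u`:
`B_f(u,ρ) = { f u' : d(u,u') ≤ ρ }`. -/
def funcBall {k : ℕ} {S : Type*} (f : (Fin k → ZMod 2) → S)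
    (u : Fin k → ZMod 2) (ρ : ℕ) : Set S :=
  f '' {u' : Fin k → ZMod 2 | hammingDist u u' ≤ ρ}

/-- `f` is `ρ`-locally binary if every function ball of radius `ρ` contains at most two
function values. -/
def LocallyBinary {k : ℕ} {S : Type*} (f : (Fin k → ZMod 2) → S) (ρ : ℕ) : Prop :=
  ∀ u : Fin k → ZMod 2, Nat.card (funcBall f u ρ) ≤ 2

/-- A function on a finite product which takes two values changes its value along some update of
a single coordinate. -/
theorem exists_update_ne_of_ne {ι : Type*} [Fintype ι] [DecidableEq ι] {α : ι → Type*} {S : Type*}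
    (f : (∀ i, α i) → S) {u v : ∀ i, α i} (h : f u ≠ f v) :
    ∃ (w : ∀ i, α i) (i : ι) (a : α i), f (Function.update w i a) ≠ f w := by
  by_contra! hf
  refine h ?_
  have key : ∀ s : Finset ι, f (s.piecewise v u) = f u := by
    intro s
    induction s using Finset.induction_on with
    | empty => simp
    | insert i s _ ih => rw [Finset.piecewise_insert, hf, ih]
  simpa using (key Finset.univ).symm

theorem hammingDist_update_le_one {ι : Type*} [Fintype ι] [DecidableEq ι] {α : ι → Type*}
    [∀ i, DecidableEq (α i)] (w : ∀ i, α i) (i : ι) (a : α i) :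
    hammingDist (Function.update w i a) w ≤ 1 := by
  rw [hammingDist, ← Finset.card_singleton i]
  refine Finset.card_le_card fun j hj => ?_
  by_contra hji
  simp_all

/-- The redundancy of a code for a function with two values is at least `2 * t`. -/
theorem IsFCC.two_mul_le {k r t : ℕ} {S : Type*} {f : (Fin k → ZMod 2) → S}
    {p : (Fin k → ZMod 2) → (Fin r → ZMod 2)} (hp : IsFCC t f p) {u v : Fin k → ZMod 2}
    (huv : f u ≠ f v) : 2 * t ≤ r := by
  obtain ⟨w, i, a, hw⟩ := exists_update_ne_of_ne f huv
  have h₁ := hp _ _ hw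
  have h₂ := hammingDist_update_le_one w i a
  have h₃ := hammingDist_le_card_fintype (x := p (Function.update w i a)) (y := p w)
  rw [Fintype.card_fin] at h₃
  omega

theorem LocallyBinary.eq_or_eq {k ρ : ℕ} {S : Type*} {f : (Fin k → ZMod 2) → S}
    (hf : LocallyBinary f ρ) {u v w : Fin k → ZMod 2} (hv : hammingDist u v ≤ ρ)
    (hw : hammingDist u w ≤ ρ) (huv : f u ≠ f v) : f w = f u ∨ f w = f v := by
  by_contra! hne
  have hsub : ({f u, f v, f w} : Set S) ⊆ funcBall f u ρ := by
    rintro _ (rfl | rfl | rfl)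
    · exact ⟨u, by simp, rfl⟩
    · exact ⟨v, hv, rfl⟩
    · exact ⟨w, hw, rfl⟩
  have h₁ := Set.ncard_le_ncard hsub ((Set.toFinite _).image f)
  have h₂ : (funcBall f u ρ).ncard ≤ 2 := hf u
  rw [Set.ncard_eq_three.2 ⟨f u, f v, f w, huv, hne.1.symm, hne.2.symm, rfl⟩] at h₁
  omega

/-- A `ρ`-locally binary function admits a two-colouring of its domain which separates any two
points at distance at most `ρ` with different values. -/
theorem LocallyBinary.exists_coloring {k ρ : ℕ} {S : Type*} {f : (Fin k → ZMod 2) → S}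
    (hf : LocallyBinary f ρ) :
    ∃ c : (Fin k → ZMod 2) → ZMod 2,
      ∀ u v, hammingDist u v ≤ ρ → f u ≠ f v → c u ≠ c v := by
  classical
  let above : (Fin k → ZMod 2) → Prop :=
    fun u => ∃ w, hammingDist u w ≤ ρ ∧ WellOrderingRel (f w) (f u)
  have key : ∀ u v, hammingDist u v ≤ ρ → WellOrderingRel (f u) (f v) →
      above v ∧ ¬ above u := by
    intro u v huv hlt
    refine ⟨⟨u, hammingDist_comm u v ▸ huv, hlt⟩, ?_⟩
    rintro ⟨w, hw, hwu⟩
    have hne : f u ≠ f v := fun h => irrefl (r := WellOrderingRel) (f v) (h ▸ hlt)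
    rcases hf.eq_or_eq huv hw hne with h | h
    · exact irrefl (r := WellOrderingRel) (f u) (h ▸ hwu)
    · exact asymm (r := WellOrderingRel) hlt (h ▸ hwu)
  refine ⟨fun u => if above u then 1 else 0, fun u v huv hne => ?_⟩
  rcases trichotomous_of WellOrderingRel (f u) (f v) with h | h | h
  · obtain ⟨hv, hu⟩ := key u v huv h
    simp [hu, hv]
  · exact absurd h hne
  · obtain ⟨hu, hv⟩ := key v u (hammingDist_comm u v ▸ huv) h
    simp [hu, hv]

theorem LocallyBinary.exists_isFCC {k t : ℕ} {S : Type*} {f : (Fin k → ZMod 2) → S}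
    (hf : LocallyBinary f (2 * t)) :
    ∃ p : (Fin k → ZMod 2) → (Fin (2 * t) → ZMod 2), IsFCC t f p := by
  obtain ⟨c, hc⟩ := hf.exists_coloring
  refine ⟨fun u _ => c u, fun u v hne => ?_⟩
  rcases le_or_gt (hammingDist u v) (2 * t) with h | h
  · have hpos : 0 < hammingDist u v := hammingDist_pos.2 fun huv => hne (congrArg f huv)
    have hrep : hammingDist (fun _ : Fin (2 * t) => c u) (fun _ => c v) = 2 * t := by
      simp [hammingDist, hc u v h hne]
    dsimp only
    omega
  · omega

/-- Optimal redundancy for locally binary functions: if `f` is `2t`-locally binary and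
its image has at least 2 elements, then `r_f(k,t) = 2t`. -/
theorem fcc_locally_binary {k t : ℕ} {S : Type*}
    (f : (Fin k → ZMod 2) → S) (hlb : LocallyBinary f (2 * t))
    (hE : 2 ≤ Nat.card (Set.range f)) :
    FCCredundancy f t = 2 * t := by
  have : Nontrivial (Set.range f) :=
    (Finite.one_lt_card_iff_nontrivial).1 (by omega)
  obtain ⟨⟨_, u, rfl⟩, ⟨_, v, rfl⟩, huv⟩ := exists_pair_ne (Set.range f)
  have hne : f u ≠ f v := fun h => huv (Subtype.ext h)
  refine le_antisymm (Nat.sInf_le hlb.exists_isFCC)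
    (le_csInf ⟨_, hlb.exists_isFCC⟩ ?_)
  rintro r ⟨p, hp⟩
  exact hp.two_mul_le hne
end
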